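/- Let α ∈ (0,1), a < b, and let f, g ∈ C¹[a,b] with g(b) = 0. Then ∫_a^b (_aD_t^α f)(t) g(t) dt = ∫_a^b f(t) (_tD_b^α g)(t) dt − (f(a)/Γ(1−α)) ∫_a^b (t−a)^{−α} g(t) dt. -/

import Mathlib

open MeasureTheory

theorem measurableSet_triangle (a b : ℝ) :
    MeasurableSet {p : ℝ × ℝ | a < p.2 ∧ p.2 < p.1 ∧ p.1 ≤ b} :=
  (measurableSet_lt measurable_const measurable_snd).inter
    ((measurableSet_lt measurable_snd measurable_fst).inter
      (measurableSet_le measurable_fst measurable_const))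

/-- Fubini's theorem on the triangle `a < s < t ≤ b`, for interval integrals, together with the
integrability of the marginal obtained by integrating out the larger variable. -/
theorem integral_triangle_swap {a b : ℝ} (hab : a ≤ b) {F : ℝ → ℝ → ℝ}
    (hF : IntegrableOn (fun p : ℝ × ℝ => F p.1 p.2) {p | a < p.2 ∧ p.2 < p.1 ∧ p.1 ≤ b}) :
    IntervalIntegrable (fun s => ∫ t in s..b, F t s) volume a b ∧
      ∫ t in a..b, ∫ s in a..t, F t s = ∫ s in a..b, ∫ t in s..b, F t s := by
  set T : Set (ℝ × ℝ) := {p | a < p.2 ∧ p.2 < p.1 ∧ p.1 ≤ b}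
  have hT : MeasurableSet T := measurableSet_triangle a b
  have hΦ : Integrable (T.indicator fun p => F p.1 p.2) (volume.prod volume) :=
    (integrable_indicator_iff hT).2 hF
  have inner_s (t : ℝ) : ∫ s, T.indicator (fun p => F p.1 p.2) (t, s) =
      (Set.Ioc a b).indicator (fun t => ∫ s in a..t, F t s) t := by
    by_cases ht : t ∈ Set.Ioc a b
    · rw [Set.indicator_of_mem ht, intervalIntegral.integral_of_le ht.1.le,
        integral_Ioc_eq_integral_Ioo, ← integral_indicator measurableSet_Ioo]
      congr 1 with s
      have := ht.2
      by_cases hs : s ∈ Set.Ioo a t <;> simp_all [Set.indicator, T]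
    · rw [Set.indicator_of_notMem ht, ← integral_zero ℝ ℝ]
      congr 1 with s
      refine Set.indicator_of_notMem (fun h => ht ?_) _
      exact ⟨h.1.trans h.2.1, h.2.2⟩
  have inner_t (s : ℝ) : ∫ t, T.indicator (fun p => F p.1 p.2) (t, s) =
      (Set.Ioc a b).indicator (fun s => ∫ t in s..b, F t s) s := by
    by_cases hs : s ∈ Set.Ioc a b
    · rw [Set.indicator_of_mem hs, intervalIntegral.integral_of_le hs.2,
        ← integral_indicator measurableSet_Ioc]
      congr 1 with t
      have := hs.1
      by_cases ht : t ∈ Set.Ioc s b <;> simp_all [Set.indicator, T]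
    · rw [Set.indicator_of_notMem hs, ← integral_zero ℝ ℝ]
      congr 1 with t
      refine Set.indicator_of_notMem (fun h => hs ?_) _
      exact ⟨h.1, h.2.1.le.trans h.2.2⟩
  constructor
  · rw [intervalIntegrable_iff_integrableOn_Ioc_of_le hab,
      ← integrable_indicator_iff measurableSet_Ioc]
    exact hΦ.integral_prod_right.congr (.of_forall inner_t)
  · have := integral_integral_swap (f := fun t s => T.indicator (fun p => F p.1 p.2) (t, s)) hΦ
    simp only [inner_s, inner_t] at this
    rw [integral_indicator measurableSet_Ioc, integral_indicator measurableSet_Ioc] at this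
    rwa [intervalIntegral.integral_of_le hab, intervalIntegral.integral_of_le hab]

/-- A weakly singular kernel times continuous functions of each variable is integrable on the
triangle `a < s < t ≤ b`. -/
theorem integrableOn_triangle_rpow_mul {α a b : ℝ} (hα : α < 1) {u v : ℝ → ℝ}
    (hu : ContinuousOn u (Set.Icc a b)) (hv : ContinuousOn v (Set.Icc a b)) :
    IntegrableOn (fun p : ℝ × ℝ => (p.1 - p.2) ^ (-α) * u p.2 * v p.1)
      {p | a < p.2 ∧ p.2 < p.1 ∧ p.1 ≤ b} := by
  have hk : Integrable ((Set.Ioc 0 (b - a)).indicator fun x : ℝ => x ^ (-α)) := by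
    rw [integrable_indicator_iff measurableSet_Ioc]
    exact (intervalIntegral.intervalIntegrable_rpow' (by linarith)).1
  have hU : Integrable ((Set.Icc a b).indicator u) :=
    (integrable_indicator_iff measurableSet_Icc).2 hu.integrableOn_Icc
  have hV : AEStronglyMeasurable ((Set.Icc a b).indicator v) volume :=
    ((integrable_indicator_iff measurableSet_Icc).2 hv.integrableOn_Icc).aestronglyMeasurable
  obtain ⟨C, hC⟩ := isCompact_Icc.exists_bound_of_continuousOn hv
  have hVC (x : ℝ) : ‖(Set.Icc a b).indicator v x‖ ≤ max C 0 := by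
    by_cases hx : x ∈ Set.Icc a b
    · rw [Set.indicator_of_mem hx]; exact (hC x hx).trans (le_max_left _ _)
    · rw [Set.indicator_of_notMem hx]; simp
  have key := (hU.convolution_integrand (ContinuousLinearMap.mul ℝ ℝ) hk).mul_bdd
    (hV.comp_fst (ν := volume)) (.of_forall fun p => hVC p.1)
  refine (key.integrableOn (s := {p | a < p.2 ∧ p.2 < p.1 ∧ p.1 ≤ b})).congr_fun ?_
    (measurableSet_triangle a b)
  rintro ⟨t, s⟩ ⟨h1, h2, h3⟩
  dsimp only at h1 h2 h3 ⊢
  rw [Set.indicator_of_mem (show s ∈ Set.Icc a b from ⟨h1.le, h2.le.trans h3⟩),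
    Set.indicator_of_mem (show t ∈ Set.Icc a b from ⟨(h1.trans h2).le, h3⟩),
    Set.indicator_of_mem (show t - s ∈ Set.Ioc 0 (b - a) from ⟨by linarith, by linarith⟩)]
  simp only [ContinuousLinearMap.mul_apply']
  ring

/-- The integral over `[s, b]` of the right-sided fractional integral of `g'`, when `g b = 0`. -/
theorem integral_integral_rpow_mul_deriv {α s b : ℝ} (hα : α < 1) (hsb : s ≤ b) {g g' : ℝ → ℝ}
    (hg : ∀ t ∈ Set.Icc s b, HasDerivAt g (g' t) t) (hg' : ContinuousOn g' (Set.Icc s b))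
    (hgb : g b = 0) :
    ∫ t in s..b, ∫ r in t..b, (r - t) ^ (-α) * g' r = -∫ t in s..b, (t - s) ^ (-α) * g t := by
  have hβ : 0 < 1 - α := by linarith
  have swap := (integral_triangle_swap hsb (F := fun t s => (t - s) ^ (-α) * 1 * g' t)
    (integrableOn_triangle_rpow_mul hα (u := fun _ => 1) continuousOn_const hg')).2
  simp only [mul_one, intervalIntegral.integral_mul_const] at swap
  have hK (r : ℝ) : ∫ t in s..r, (r - t) ^ (-α) = (r - s) ^ (1 - α) / (1 - α) := by
    rw [intervalIntegral.integral_comp_sub_left (fun x => x ^ (-α)),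
      integral_rpow (by left; linarith)]
    have : -α + 1 = 1 - α := by ring
    rw [this, sub_self, Real.zero_rpow hβ.ne', sub_zero]
  simp only [hK] at swap
  rw [← swap]
  have hgc : ContinuousOn g (Set.uIcc s b) := by
    rw [Set.uIcc_of_le hsb]; exact fun t ht => (hg t ht).continuousAt.continuousWithinAt
  have parts := intervalIntegral.integral_mul_deriv_eq_deriv_mul_of_hasDerivAt (a := s) (b := b)
    (u := fun r => (r - s) ^ (1 - α) / (1 - α)) (u' := fun r => (r - s) ^ (-α)) (v := g) (v' := g')
    (Continuous.continuousOn ((Real.continuous_rpow_const hβ.le).comp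
      (continuous_id.sub continuous_const) |>.div_const _)) hgc
    (fun r hr => by
      rw [min_eq_left hsb] at hr
      have h0 : r - s ≠ 0 := by linarith [hr.1]
      convert! (((hasDerivAt_id r).sub_const s).rpow_const (p := 1 - α) (.inl h0)).div_const (1 - α)
        using 1
      have : 1 - α - 1 = -α := by ring
      rw [this]
      simp only [id]
      field_simp)
    (fun r hr => by
      rw [min_eq_left hsb, max_eq_right hsb] at hr
      exact hg r ⟨hr.1.le, hr.2.le⟩)
    (by
      have := (intervalIntegral.intervalIntegrable_rpow' (r := -α) (a := 0) (b := b - s)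
        (by linarith)).comp_sub_right s
      simpa using this)
    (hg'.intervalIntegrable_of_Icc hsb)
  rw [parts, hgb, sub_self, Real.zero_rpow hβ.ne']
  ring

/-- **Integration by parts for Caputo fractional derivatives.**
For `α ∈ (0,1)`, `a < b`, `f, g ∈ C¹[a,b]` with `g(b) = 0`:
`∫_a^b (ₐD_t^α f)(t) g(t) dt = ∫_a^b f(t) (ₜD_b^α g)(t) dt
  − (f(a)/Γ(1−α)) ∫_a^b (t−a)^{−α} g(t) dt`. -/
theorem caputo_integration_by_parts (α a b : ℝ) (hα0 : 0 < α) (hα1 : α < 1) (hab : a < b)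
    (f f' g g' : ℝ → ℝ)
    (hf : ∀ t ∈ Set.Icc a b, HasDerivAt f (f' t) t)
    (hf' : ContinuousOn f' (Set.Icc a b))
    (hg : ∀ t ∈ Set.Icc a b, HasDerivAt g (g' t) t)
    (hg' : ContinuousOn g' (Set.Icc a b))
    (hgb : g b = 0) :
    (∫ t in a..b, (1 / Real.Gamma (1 - α) * ∫ s in a..t, (t - s) ^ (-α) * f' s) * g t)
      = (∫ t in a..b, f t * (-(1 / Real.Gamma (1 - α)) * ∫ s in t..b, (s - t) ^ (-α) * g' s))
        - f a / Real.Gamma (1 - α) * ∫ t in a..b, (t - a) ^ (-α) * g t := by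
  have hgc : ContinuousOn g (Set.Icc a b) := fun t ht => (hg t ht).continuousAt.continuousWithinAt
  have hfc : ContinuousOn f (Set.Icc a b) := fun t ht => (hf t ht).continuousAt.continuousWithinAt
  set G : ℝ → ℝ := fun t => ∫ s in t..b, (s - t) ^ (-α) * g' s
  have tail (s : ℝ) (hs : s ∈ Set.Icc a b) :
      ∫ t in s..b, G t = -∫ t in s..b, (t - s) ^ (-α) * g t :=
    integral_integral_rpow_mul_deriv hα1 hs.2 (fun t ht => hg t ⟨hs.1.trans ht.1, ht.2⟩)
      (hg'.mono (Set.Icc_subset_Icc_left hs.1)) hgb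
  have hGint : IntervalIntegrable G volume a b := by
    have := (integral_triangle_swap hab.le (F := fun t s => (t - s) ^ (-α) * 1 * g' t)
      (integrableOn_triangle_rpow_mul hα1 (u := fun _ => 1) continuousOn_const hg')).1
    simpa only [mul_one] using this
  have swapL : ∫ t in a..b, (∫ s in a..t, (t - s) ^ (-α) * f' s) * g t
      = ∫ s in a..b, f' s * ∫ t in s..b, (t - s) ^ (-α) * g t := by
    have := (integral_triangle_swap hab.le (F := fun t s => (t - s) ^ (-α) * f' s * g t)
      (integrableOn_triangle_rpow_mul hα1 hf' hgc)).2
    simp only [intervalIntegral.integral_mul_const] at this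
    rw [this]
    congr 1 with s
    rw [← intervalIntegral.integral_const_mul]
    congr 1 with t
    ring
  have hprod : IntegrableOn (fun p : ℝ × ℝ => G p.1 * f' p.2)
      {p | a < p.2 ∧ p.2 < p.1 ∧ p.1 ≤ b} := by
    have h1 : IntegrableOn G (Set.Ioc a b) := hGint.1
    have h2 : IntegrableOn f' (Set.Ioc a b) := (hf'.intervalIntegrable_of_Icc hab.le).1
    have h3 := Integrable.mul_prod h1 h2
    rw [Measure.prod_restrict] at h3
    exact IntegrableOn.mono_set h3 fun p ⟨h1, h2, h3⟩ => ⟨⟨h1.trans h2, h3⟩, h1, h2.le.trans h3⟩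
  have swapR : ∫ t in a..b, G t * (f t - f a) = ∫ s in a..b, (∫ t in s..b, G t) * f' s := by
    have := (integral_triangle_swap hab.le (F := fun t s => G t * f' s) hprod).2
    simp only [intervalIntegral.integral_mul_const, intervalIntegral.integral_const_mul] at this
    rw [← this]
    refine intervalIntegral.integral_congr fun t ht => ?_
    rw [Set.uIcc_of_le hab.le] at ht
    have hsub : Set.uIcc a t ⊆ Set.Icc a b := by
      rw [Set.uIcc_of_le ht.1]; exact Set.Icc_subset_Icc_right ht.2
    rw [intervalIntegral.integral_eq_sub_of_hasDerivAt (fun x hx => hf x (hsub hx))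
      (hf'.mono hsub).intervalIntegrable]
  have combine : ∫ t in a..b, (∫ s in a..t, (t - s) ^ (-α) * f' s) * g t
      = -∫ t in a..b, G t * (f t - f a) := by
    rw [swapL, swapR, ← intervalIntegral.integral_neg]
    refine intervalIntegral.integral_congr fun s hs => ?_
    rw [Set.uIcc_of_le hab.le] at hs
    simp only [tail s hs]
    ring
  have split : ∫ t in a..b, G t * (f t - f a)
      = (∫ t in a..b, f t * G t) - f a * ∫ t in a..b, G t := by
    rw [← intervalIntegral.integral_const_mul, ← intervalIntegral.integral_sub]
    · congr 1 with t
      ring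
    · exact hGint.continuousOn_mul (by rwa [Set.uIcc_of_le hab.le])
    · exact hGint.const_mul _
  rw [split, tail a ⟨le_rfl, hab.le⟩] at combine
  simp only [mul_assoc, mul_left_comm (f _) (-(1 / Real.Gamma (1 - α))),
    intervalIntegral.integral_const_mul]
  rw [combine]
  ring
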